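/- Let K be a field of characteristic zero, R = K[x,y,z], and let a, b, α, β, γ be integers with a ≥ b+1, 1 ≤ α ≤ a−1, 1 ≤ γ ≤ 2, α + γ = b, and 1 ≤ β ≤ min{a−b, b−1}. Then the quotient of R by the ideal I_β = (x^a, y^b − x^α z^γ, z^3, x^{a−α} y^{b−β}, y^{b−β} z^{3−γ}) has the weak Lefschetz property. -/

import Mathlib

open MvPolynomial

/-- The degree-`i` graded component of `R/I`, i.e. the image in `R/I` of the
space of homogeneous polynomials of degree `i`. -/
noncomputable def grComponent (K : Type*) [Field K]
    (I : Ideal (MvPolynomial (Fin 3) K)) (i : ℕ) :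
    Submodule K (MvPolynomial (Fin 3) K ⧸ I) :=
  (MvPolynomial.homogeneousSubmodule (Fin 3) K i).map
    (Ideal.Quotient.mkₐ K I).toLinearMap

/-- The Hilbert function of `R/I`. -/
noncomputable def hilb (K : Type*) [Field K]
    (I : Ideal (MvPolynomial (Fin 3) K)) (i : ℕ) : ℕ :=
  Module.finrank K (grComponent K I i)

/-- `R/I` has the weak Lefschetz property: there is a linear form `L` such that
for every `i`, multiplication by `L` from `[R/I]_i` to `[R/I]_{i+1}` is
injective or surjective. -/
def hasWLP (K : Type*) [Field K] (I : Ideal (MvPolynomial (Fin 3) K)) : Prop :=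
  ∃ L : MvPolynomial (Fin 3) K, L.IsHomogeneous 1 ∧
    ∀ i : ℕ,
      (∀ u ∈ grComponent K I i, ∀ v ∈ grComponent K I i,
          Ideal.Quotient.mk I L * u = Ideal.Quotient.mk I L * v → u = v) ∨
      (∀ w ∈ grComponent K I (i + 1), ∃ u ∈ grComponent K I i,
          Ideal.Quotient.mk I L * u = w)

theorem degree_fin_three (m : Fin 3 →₀ ℕ) : m.degree = m 0 + m 1 + m 2 := by
  rw [Finsupp.degree_eq_sum, Fin.sum_univ_three]

theorem monomial_fin_three {K : Type*} [CommSemiring K] (m : Fin 3 →₀ ℕ) (c : K) :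
    monomial m c = C c * (X 0 ^ m 0 * X 1 ^ m 1 * X 2 ^ m 2) := by
  rw [monomial_eq, Finsupp.prod_fintype _ _ (fun _ => pow_zero _), Fin.prod_univ_three]

/-- The exponent vector of `x ^ i * y ^ j * z ^ k`. -/
noncomputable def expVec (i j k : ℕ) : Fin 3 →₀ ℕ := Finsupp.equivFunOnFinite.symm ![i, j, k]

@[simp] theorem expVec_zero (i j k : ℕ) : expVec i j k 0 = i := rfl

@[simp] theorem expVec_one (i j k : ℕ) : expVec i j k 1 = j := rfl

@[simp] theorem expVec_two (i j k : ℕ) : expVec i j k 2 = k := rfl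

theorem expVec_le_iff {i j k : ℕ} {m : Fin 3 →₀ ℕ} :
    expVec i j k ≤ m ↔ i ≤ m 0 ∧ j ≤ m 1 ∧ k ≤ m 2 := by
  rw [Finsupp.le_def, Fin.forall_fin_succ, Fin.forall_fin_two]
  rfl

theorem coeff_mul_X_pow_fin_three {K : Type*} [CommSemiring K] (q : MvPolynomial (Fin 3) K)
    (i j k : ℕ) (m : Fin 3 →₀ ℕ) :
    coeff m (q * (X 0 ^ i * X 1 ^ j * X 2 ^ k)) =
      if i ≤ m 0 ∧ j ≤ m 1 ∧ k ≤ m 2 then coeff (m - expVec i j k) q else 0 := by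
  have h : (X 0 ^ i * X 1 ^ j * X 2 ^ k : MvPolynomial (Fin 3) K) =
      monomial (expVec i j k) 1 := by
    simp [monomial_fin_three]
  rw [h, coeff_mul_monomial']
  simp only [expVec_le_iff, mul_one]

/-- In degree at most `s.degree`, a multiple of a monomial with exponent `s` is a multiple
by a constant. -/
theorem coeff_mul_X_pow_of_degree_le {K : Type*} [CommSemiring K] (q : MvPolynomial (Fin 3) K)
    (i j k : ℕ) (m : Fin 3 →₀ ℕ) (hm : m.degree ≤ i + j + k) :
    coeff m (q * (X 0 ^ i * X 1 ^ j * X 2 ^ k)) =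
      if m 0 = i ∧ m 1 = j ∧ m 2 = k then coeff 0 q else 0 := by
  rw [degree_fin_three] at hm
  rw [coeff_mul_X_pow_fin_three]
  by_cases h : m 0 = i ∧ m 1 = j ∧ m 2 = k
  · have hs : m - expVec i j k = 0 := by
      ext t
      fin_cases t <;> simp [h]
    rw [if_pos h, if_pos ⟨h.1.ge, h.2.1.ge, h.2.2.ge⟩, hs]
  · rw [if_neg h, if_neg (by omega)]

theorem mem_grComponent_iff {K : Type*} [Field K] {I : Ideal (MvPolynomial (Fin 3) K)} {i : ℕ}
    {u : MvPolynomial (Fin 3) K ⧸ I} :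
    u ∈ grComponent K I i ↔ ∃ f, f.IsHomogeneous i ∧ Ideal.Quotient.mk I f = u :=
  Iff.rfl

/-- The ideal `(x ^ a, y ^ b - x ^ α z ^ γ, z ^ 3, x ^ (a - α) y ^ (b - β),
y ^ (b - β) z ^ (3 - γ))`. -/
noncomputable def almostMonomialIdeal (K : Type*) [Field K] (a b α β γ : ℕ) :
    Ideal (MvPolynomial (Fin 3) K) :=
  Ideal.span {(X 0 : MvPolynomial (Fin 3) K) ^ a,
      X 1 ^ b - X 0 ^ α * X 2 ^ γ, X 2 ^ 3,
      X 0 ^ (a - α) * X 1 ^ (b - β), X 1 ^ (b - β) * X 2 ^ (3 - γ)}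

section

variable {K : Type*} [Field K] {a b α β γ : ℕ}

/-- An element of the ideal without a `y ^ b` term agrees, in degrees at most `b`, with an
element of `(z ^ 3, y ^ (b - β) z ^ (3 - γ))`. -/
theorem coeff_eq_zero_of_mem_almostMonomialIdeal {p : MvPolynomial (Fin 3) K}
    (hp : p ∈ almostMonomialIdeal K a b α β γ) (hα : 1 ≤ α) (hαa : α < a) (hγ1 : 1 ≤ γ)
    (hγ2 : γ ≤ 2) (hαγ : α + γ = b) (hβ : β < b) (hβa : b + β ≤ a)
    (hy : coeff (expVec 0 b 0) p = 0) (m : Fin 3 →₀ ℕ) (hm : m.degree ≤ b) (hz : m 2 < 3)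
    (hyz : m 1 < b - β ∨ m 2 < 3 - γ) (hba : b < a) : coeff m p = 0 := by
  simp only [almostMonomialIdeal, Ideal.mem_span_insert, Ideal.mem_span_singleton'] at hp
  obtain ⟨q₁, _, ⟨q₂, _, ⟨q₃, _, ⟨q₄, _, ⟨q₅, rfl⟩, rfl⟩, rfl⟩, rfl⟩, rfl⟩ := hp
  have expand : q₁ * X 0 ^ a + (q₂ * (X 1 ^ b - X 0 ^ α * X 2 ^ γ) + (q₃ * X 2 ^ 3 +
      (q₄ * (X 0 ^ (a - α) * X 1 ^ (b - β)) + q₅ * (X 1 ^ (b - β) * X 2 ^ (3 - γ))))) =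
      q₁ * (X 0 ^ a * X 1 ^ 0 * X 2 ^ 0) + (q₂ * (X 0 ^ 0 * X 1 ^ b * X 2 ^ 0) -
      q₂ * (X 0 ^ α * X 1 ^ 0 * X 2 ^ γ) + (q₃ * (X 0 ^ 0 * X 1 ^ 0 * X 2 ^ 3) +
      (q₄ * (X 0 ^ (a - α) * X 1 ^ (b - β) * X 2 ^ 0) +
      q₅ * (X 0 ^ 0 * X 1 ^ (b - β) * X 2 ^ (3 - γ))))) := by
    ring
  have key : ∀ n : Fin 3 →₀ ℕ, n.degree ≤ b → n 2 < 3 → (n 1 < b - β ∨ n 2 < 3 - γ) →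
      coeff n (q₁ * X 0 ^ a + (q₂ * (X 1 ^ b - X 0 ^ α * X 2 ^ γ) + (q₃ * X 2 ^ 3 +
        (q₄ * (X 0 ^ (a - α) * X 1 ^ (b - β)) + q₅ * (X 1 ^ (b - β) * X 2 ^ (3 - γ)))))) =
      (if n 0 = 0 ∧ n 1 = b ∧ n 2 = 0 then coeff 0 q₂ else 0) -
      (if n 0 = α ∧ n 1 = 0 ∧ n 2 = γ then coeff 0 q₂ else 0) := by
    intro n hn hnz hnyz
    have hn' := hn
    rw [degree_fin_three] at hn'
    simp only [expand, coeff_add, coeff_sub]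
    rw [coeff_mul_X_pow_of_degree_le q₂ 0 b 0 n (by omega),
      coeff_mul_X_pow_of_degree_le q₂ α 0 γ n (by omega)]
    simp only [coeff_mul_X_pow_fin_three]
    rw [if_neg (show ¬(a ≤ n 0 ∧ 0 ≤ n 1 ∧ 0 ≤ n 2) by omega),
      if_neg (show ¬(0 ≤ n 0 ∧ 0 ≤ n 1 ∧ 3 ≤ n 2) by omega),
      if_neg (show ¬(a - α ≤ n 0 ∧ b - β ≤ n 1 ∧ 0 ≤ n 2) by omega),
      if_neg (show ¬(0 ≤ n 0 ∧ b - β ≤ n 1 ∧ 3 - γ ≤ n 2) by omega)]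
    ring
  have hq : coeff 0 q₂ = 0 := by
    rw [key _ (by simp [degree_fin_three]) (by simp) (by simp; omega)] at hy
    simpa [show (0 : ℕ) ≠ α by omega] using hy
  rw [key m hm hz hyz, hq]
  simp

theorem monomial_mem_almostMonomialIdeal {m : Fin 3 →₀ ℕ} (c : K)
    (h : 3 ≤ m 2 ∨ b - β ≤ m 1 ∧ 3 - γ ≤ m 2) :
    monomial m c ∈ almostMonomialIdeal K a b α β γ := by
  rw [monomial_fin_three]
  rcases h with h | ⟨h₁, h₂⟩
  · refine Ideal.mem_of_dvd _ ?_ (Ideal.subset_span (a := X 2 ^ 3) (by simp))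
    exact ((pow_dvd_pow _ h).mul_left _).mul_left _
  · refine Ideal.mem_of_dvd _ ?_
      (Ideal.subset_span (a := X 1 ^ (b - β) * X 2 ^ (3 - γ)) (by simp))
    exact (mul_dvd_mul ((pow_dvd_pow _ h₁).mul_left _) (pow_dvd_pow _ h₂)).mul_left _

theorem mem_almostMonomialIdeal_of_X_mul_mem {f : MvPolynomial (Fin 3) K} {i : ℕ}
    (hf : f.IsHomogeneous i) (hi : i < b)
    (hXf : X 0 * f ∈ almostMonomialIdeal K a b α β γ) (hα : 1 ≤ α) (hαa : α < a) (hγ1 : 1 ≤ γ)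
    (hγ2 : γ ≤ 2) (hαγ : α + γ = b) (hβ : β < b) (hβa : b + β ≤ a) (hba : b < a) :
    f ∈ almostMonomialIdeal K a b α β γ := by
  rw [← f.support_sum_monomial_coeff]
  refine Ideal.sum_mem _ fun m hm => ?_
  apply monomial_mem_almostMonomialIdeal
  by_contra! h
  refine mem_support_iff.mp hm ?_
  have hdeg : m.degree = i := by
    by_contra hne
    exact mem_support_iff.mp hm (hf.coeff_eq_zero hne)
  rw [← coeff_X_mul m 0 f]
  refine coeff_eq_zero_of_mem_almostMonomialIdeal hXf hα hαa hγ1 hγ2 hαγ hβ hβa ?_ _ ?_ ?_ ?_ hba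
  · rw [coeff_X_mul', if_neg (by simp)]
  · rw [map_add, hdeg, Finsupp.degree_single]
    omega
  · simpa using h.1
  · simp
    omega

theorem mk_monomial_mem_map_mul_X {m : Fin 3 →₀ ℕ} {i : ℕ} (c : K) (hm : m.degree = i + 1)
    (hi : b ≤ i) (hα : 1 ≤ α) (hγ1 : 1 ≤ γ) (hαγ : α + γ = b) (hβ : 1 ≤ β) :
    Ideal.Quotient.mk (almostMonomialIdeal K a b α β γ) (monomial m c) ∈
      (grComponent K (almostMonomialIdeal K a b α β γ) i).map
        (LinearMap.mulLeft K (Ideal.Quotient.mk _ (X 0))) := by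
  set I := almostMonomialIdeal K a b α β γ
  rw [degree_fin_three] at hm
  have of_sub_mem : ∀ n : Fin 3 →₀ ℕ, n.degree = i →
      monomial m c - X 0 * monomial n c ∈ I →
      Ideal.Quotient.mk I (monomial m c) ∈
        (grComponent K I i).map (LinearMap.mulLeft K (Ideal.Quotient.mk I (X 0))) := by
    intro n hn hmem
    refine ⟨Ideal.Quotient.mk I (monomial n c),
      mem_grComponent_iff.mpr ⟨_, isHomogeneous_monomial c hn, rfl⟩, ?_⟩
    rw [LinearMap.mulLeft_apply, ← map_mul]
    exact (Ideal.Quotient.eq.mpr hmem).symm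
  by_cases h₀ : 1 ≤ m 0
  · refine of_sub_mem (expVec (m 0 - 1) (m 1) (m 2)) (by simp [degree_fin_three]; omega) ?_
    obtain ⟨k, hk⟩ := Nat.exists_eq_add_of_le' h₀
    convert I.zero_mem
    simp only [monomial_fin_three, expVec_zero, expVec_one, expVec_two, hk, Nat.add_sub_cancel]
    ring
  by_cases h₁ : b ≤ m 1
  · refine of_sub_mem (expVec (α - 1) (m 1 - b) (m 2 + γ)) (by simp [degree_fin_three]; omega) ?_
    obtain ⟨k, hk⟩ := Nat.exists_eq_add_of_le' h₁
    obtain ⟨α', rfl⟩ := Nat.exists_eq_add_of_le' hα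
    have h : (X 1 ^ b - X 0 ^ (α' + 1) * X 2 ^ γ : MvPolynomial (Fin 3) K) ∈ I :=
      Ideal.subset_span (by simp)
    convert I.mul_mem_left (C c * (X 1 ^ k * X 2 ^ m 2)) h using 1
    simp only [monomial_fin_three, expVec_zero, expVec_one, expVec_two, hk, Nat.add_sub_cancel,
      show m 0 = 0 by omega]
    ring
  · rw [Ideal.Quotient.eq_zero_iff_mem.mpr (monomial_mem_almostMonomialIdeal c (by omega))]
    exact Submodule.zero_mem _

end

theorem stmt_16 (K : Type*) [Field K] [CharZero K] (a b α β γ : ℕ)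
    (hab : b + 1 ≤ a)
    (hα1 : 1 ≤ α) (hα2 : α ≤ a - 1)
    (hγ1 : 1 ≤ γ) (hγ2 : γ ≤ 2)
    (hαγ : α + γ = b)
    (hβ1 : 1 ≤ β) (hβ2 : β ≤ min (a - b) (b - 1)) :
    hasWLP K (Ideal.span {(X 0 : MvPolynomial (Fin 3) K) ^ a,
      X 1 ^ b - X 0 ^ α * X 2 ^ γ, X 2 ^ 3,
      X 0 ^ (a - α) * X 1 ^ (b - β), X 1 ^ (b - β) * X 2 ^ (3 - γ)}) := by
  have hβa : b + β ≤ a := by omega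
  have hβb : β < b := by omega
  change hasWLP K (almostMonomialIdeal K a b α β γ)
  refine ⟨X 0, isHomogeneous_X K 0, fun i => ?_⟩
  rcases lt_or_ge i b with hi | hi
  · left
    rintro _ ⟨f, hf, rfl⟩ _ ⟨g, hg, rfl⟩ h
    refine Ideal.Quotient.eq.mpr (mem_almostMonomialIdeal_of_X_mul_mem
      (IsHomogeneous.sub hf hg) hi ?_ hα1 (by omega) hγ1 hγ2 hαγ hβb hβa hab)
    rw [mul_sub]
    exact Ideal.Quotient.eq.mp (by simpa using h)
  · right
    rintro _ ⟨f, hf, rfl⟩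
    suffices h : Ideal.Quotient.mk (almostMonomialIdeal K a b α β γ) f ∈
        (grComponent K (almostMonomialIdeal K a b α β γ) i).map
          (LinearMap.mulLeft K (Ideal.Quotient.mk _ (X 0))) from h
    rw [← f.support_sum_monomial_coeff, map_sum]
    refine Submodule.sum_mem _ fun m hm => ?_
    refine mk_monomial_mem_map_mul_X _ ?_ hi hα1 hγ1 hαγ hβ1
    by_contra hne
    exact mem_support_iff.mp hm (IsHomogeneous.coeff_eq_zero hf hne)
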